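/- Let 𝒯 be a triangulated category and α₁, …, α_c elements of the graded center of 𝒯, each induced by an action F_i of a monoidal triangulated category on 𝒯 admitting a strong Verdier structure. Then level_𝒯^X(Y//(α₁,…,α_c)) ≤ level_𝒯^X(Y) + c for all X, Y in 𝒯. -/

import Mathlib

open CategoryTheory Category Limits Pretriangulated MonoidalCategory

universe v₁ v₂ v₃ u₁ u₂ u₃

section Defs

variable {C : Type u₁} [Category.{v₁} C] [Preadditive C] [HasZeroObject C] [HasShift C ℤ]
  [∀ n : ℤ, (shiftFunctor C n).Additive] [Pretriangulated C] [HasBinaryBiproducts C]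

/-- The square with sides `f : T ⟶ U`, `g : T ⟶ V`, `g' : U ⟶ X`, `f' : V ⟶ X`
is homotopy cartesian. -/
def HomotopyCartesian {T U V X : C} (f : T ⟶ U) (g : T ⟶ V) (g' : U ⟶ X) (f' : V ⟶ X) : Prop :=
  ∃ δ : X ⟶ T⟦(1 : ℤ)⟧,
    Triangle.mk (biprod.lift f (-g)) (biprod.desc g' f') δ ∈ distTriang C

/-- The smallest class of objects containing `X` that is closed under (de)suspensions,
finite coproducts and retracts. -/
inductive Thick1 (X : C) : C → Prop
  | base : Thick1 X X
  | zero (Z : C) : Limits.IsZero Z → Thick1 X Z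
  | shift (n : ℤ) (Y : C) : Thick1 X Y → Thick1 X (Y⟦n⟧)
  | sum (Y Z : C) : Thick1 X Y → Thick1 X Z → Thick1 X (Y ⊞ Z)
  | retract (Y Z : C) (i : Z ⟶ Y) (r : Y ⟶ Z) : i ≫ r = 𝟙 Z → Thick1 X Y → Thick1 X Z

/-- `ThickN X n Y` means `Y ∈ thick^n_𝒯(X)`. -/
def ThickN (X : C) : ℕ → C → Prop
  | 0, Y => Limits.IsZero Y
  | 1, Y => Thick1 X Y
  | (n + 2), Y => ∃ (Y' Ytil Y'' : C) (a : Y' ⟶ Y ⊞ Ytil) (b : Y ⊞ Ytil ⟶ Y'')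
      (c : Y'' ⟶ Y'⟦(1 : ℤ)⟧), (Triangle.mk a b c ∈ distTriang C) ∧
      Thick1 X Y' ∧ ThickN X (n + 1) Y''

/-- The `X`-level of `Y`: the least `n` such that `Y ∈ thick^n(X)` (and `⊤` if there
is no such `n`). -/
noncomputable def level (X Y : C) : ℕ∞ :=
  sInf {n : ℕ∞ | ∃ m : ℕ, n = m ∧ ThickN X m Y}

end Defs

section Biexact

variable {C : Type u₁} [Category.{v₁} C] [Preadditive C] [HasZeroObject C] [HasShift C ℤ]
  [∀ n : ℤ, (shiftFunctor C n).Additive] [Pretriangulated C] [HasBinaryBiproducts C]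
variable {D : Type u₂} [Category.{v₂} D] [Preadditive D] [HasZeroObject D] [HasShift D ℤ]
  [∀ n : ℤ, (shiftFunctor D n).Additive] [Pretriangulated D] [HasBinaryBiproducts D]
variable {E : Type u₃} [Category.{v₃} E] [Preadditive E] [HasZeroObject E] [HasShift E ℤ]
  [∀ n : ℤ, (shiftFunctor E n).Additive] [Pretriangulated E] [HasBinaryBiproducts E]

/-- A biexact functor of triangulated categories: a bifunctor together with natural
isomorphisms `θ : F(Σⁿ-,-) ≅ ΣⁿF(-,-)` and `ζ : F(-,Σⁿ-) ≅ ΣⁿF(-,-)` which are exact in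
each variable and anticommute. -/
structure Biexact (F : C ⥤ D ⥤ E) where
  θ : ∀ (n : ℤ) (X : C) (X' : D), (F.obj (X⟦n⟧)).obj X' ≅ ((F.obj X).obj X')⟦n⟧
  ζ : ∀ (n : ℤ) (X : C) (X' : D), (F.obj X).obj (X'⟦n⟧) ≅ ((F.obj X).obj X')⟦n⟧
  θ_natural₁ : ∀ (n : ℤ) {X Y : C} (f : X ⟶ Y) (X' : D),
    (F.map (f⟦n⟧')).app X' ≫ (θ n Y X').hom = (θ n X X').hom ≫ ((F.map f).app X')⟦n⟧'
  θ_natural₂ : ∀ (n : ℤ) (X : C) {X' Y' : D} (g : X' ⟶ Y'),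
    (F.obj (X⟦n⟧)).map g ≫ (θ n X Y').hom = (θ n X X').hom ≫ (((F.obj X).map g)⟦n⟧')
  ζ_natural₁ : ∀ (n : ℤ) {X Y : C} (f : X ⟶ Y) (X' : D),
    (F.map f).app (X'⟦n⟧) ≫ (ζ n Y X').hom = (ζ n X X').hom ≫ (((F.map f).app X')⟦n⟧')
  ζ_natural₂ : ∀ (n : ℤ) (X : C) {X' Y' : D} (g : X' ⟶ Y'),
    (F.obj X).map (g⟦n⟧') ≫ (ζ n X Y').hom = (ζ n X X').hom ≫ (((F.obj X).map g)⟦n⟧')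
  ex₁ : ∀ (T : Triangle C), (T ∈ distTriang C) → ∀ (X' : D),
    Triangle.mk ((F.map T.mor₁).app X') ((F.map T.mor₂).app X')
      ((F.map T.mor₃).app X' ≫ (θ 1 T.obj₁ X').hom) ∈ distTriang E
  ex₂ : ∀ (X : C) (T : Triangle D), (T ∈ distTriang D) →
    Triangle.mk ((F.obj X).map T.mor₁) ((F.obj X).map T.mor₂)
      ((F.obj X).map T.mor₃ ≫ (ζ 1 X T.obj₁).hom) ∈ distTriang E
  anticomm : ∀ (X : C) (X' : D),
    (θ 1 X (X'⟦(1 : ℤ)⟧)).hom ≫ (((ζ 1 X X').hom)⟦(1 : ℤ)⟧') =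
      -((ζ 1 (X⟦(1 : ℤ)⟧) X').hom ≫ (((θ 1 X X').hom)⟦(1 : ℤ)⟧'))

/-- A biexact functor admits a strong Verdier structure: for every pair of exact triangles
there is an object `W` together with three exact triangles as in
Keller–Neeman/Aldrovandi–Lester, such that the resulting `4 × 4` diagram commutes and the
six designated squares are homotopy cartesian (the last one after changing a sign). -/
def StrongVerdier (F : C ⥤ D ⥤ E) (B : Biexact F) : Prop :=
  ∀ {X Y Z : C} {f : X ⟶ Y} {g : Y ⟶ Z} {h : Z ⟶ X⟦(1 : ℤ)⟧},
    (Triangle.mk f g h ∈ distTriang C) →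
  ∀ {X' Y' Z' : D} {f' : X' ⟶ Y'} {g' : Y' ⟶ Z'} {h' : Z' ⟶ X'⟦(1 : ℤ)⟧},
    (Triangle.mk f' g' h' ∈ distTriang D) →
  ∃ (W : E) (j : (F.obj X).obj Y' ⟶ W) (q : W ⟶ (F.obj Z).obj X')
    (i : W ⟶ (F.obj Y).obj Y') (p : (F.obj Z).obj Z' ⟶ W⟦(1 : ℤ)⟧)
    (j' : (F.obj Y).obj X' ⟶ W) (q' : W ⟶ (F.obj X).obj Z'),
    -- the three exact triangles
    (Triangle.mk j q ((F.map h).app X' ≫ (F.obj (X⟦(1 : ℤ)⟧)).map f' ≫ (B.θ 1 X Y').hom)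
        ∈ distTriang E) ∧
    (Triangle.mk i ((F.map g).app Y' ≫ (F.obj Z).map g') p ∈ distTriang E) ∧
    (Triangle.mk j' q' ((F.map f).app Z' ≫ (F.obj Y).map h' ≫ (B.ζ 1 Y X').hom)
        ∈ distTriang E) ∧
    -- the triangles (i)–(vi) commute
    j ≫ i = (F.map f).app Y' ∧
    j' ≫ i = (F.obj Y).map f' ∧
    j' ≫ q = (F.map g).app X' ∧
    j ≫ q' = (F.obj X).map g' ∧
    p ≫ (q'⟦(1 : ℤ)⟧') = (F.map h).app Z' ≫ (B.θ 1 X Z').hom ∧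
    p ≫ (q⟦(1 : ℤ)⟧') = (F.obj Z).map h' ≫ (B.ζ 1 Z X').hom ∧
    -- the squares (I)–(VI) are homotopy cartesian
    HomotopyCartesian ((F.map f).app X') ((F.obj X).map f') j' j ∧
    HomotopyCartesian i q ((F.map g).app Y') ((F.obj Z).map f') ∧
    HomotopyCartesian i q' ((F.obj Y).map g') ((F.map f).app Z') ∧
    HomotopyCartesian ((F.map h).app Y' ≫ (B.θ 1 X Y').hom) ((F.obj Z).map g')
      (j⟦(1 : ℤ)⟧') p ∧
    HomotopyCartesian ((F.map g).app Z') ((F.obj Y).map h' ≫ (B.ζ 1 Y X').hom) p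
      (j'⟦(1 : ℤ)⟧') ∧
    HomotopyCartesian q q' ((F.map h).app X' ≫ (B.θ 1 X X').hom)
      (-((F.obj X).map h' ≫ (B.ζ 1 X X').hom))

end Biexact

section Central

variable (C : Type u₁) [Category.{v₁} C] [Preadditive C] [HasZeroObject C] [HasShift C ℤ]
  [∀ n : ℤ, (shiftFunctor C n).Additive] [Pretriangulated C] [HasBinaryBiproducts C]

/-- An element of degree `d` of the graded center of the triangulated category `C`:
a natural transformation `id ⟶ Σᵈ` with `α Σ = (-1)^d Σ α`. -/
structure Central where
  d : ℤ
  app : ∀ X : C, X ⟶ X⟦d⟧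
  naturality : ∀ {X Y : C} (f : X ⟶ Y), app X ≫ (f⟦d⟧') = f ≫ app Y
  central : ∀ X : C,
    app (X⟦(1 : ℤ)⟧) ≫ (shiftComm X (1 : ℤ) d).hom = d.negOnePow • ((app X)⟦(1 : ℤ)⟧')

variable {C}

/-- `K` is a cone of `f`. -/
def IsCone {X Y : C} (f : X ⟶ Y) (K : C) : Prop :=
  ∃ (a : Y ⟶ K) (b : K ⟶ X⟦(1 : ℤ)⟧), Triangle.mk f a b ∈ distTriang C

/-- `K` is a Koszul object of the sequence `αs` of central elements on `X`. -/
def IsKoszulObj : List (Central C) → C → C → Prop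
  | [], X, K => Nonempty (X ≅ K)
  | α :: rest, X, K => ∃ K' : C, IsCone (α.app X) K' ∧ IsKoszulObj rest K' K

variable {S : Type u₂} [Category.{v₂} S] [Preadditive S] [HasZeroObject S] [HasShift S ℤ]
  [∀ n : ℤ, (shiftFunctor S n).Additive] [Pretriangulated S] [HasBinaryBiproducts S]
  [MonoidalCategory S]

/-- An action of a monoidal triangulated category `(S, ⊗, 𝟙)` on `C`: a biexact functor
together with associativity and unit isomorphisms, natural in each variable. -/
structure MonoidalAction (F : S ⥤ C ⥤ C) extends Biexact F where
  assoc : ∀ (A B : S) (X : C), (F.obj A).obj ((F.obj B).obj X) ≅ (F.obj (A ⊗ B)).obj X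
  unit : ∀ X : C, (F.obj (𝟙_ S)).obj X ≅ X
  unit_naturality : ∀ {X Y : C} (f : X ⟶ Y),
    (F.obj (𝟙_ S)).map f ≫ (unit Y).hom = (unit X).hom ≫ f
  assoc_naturality : ∀ (A B : S) {X Y : C} (f : X ⟶ Y),
    (F.obj A).map ((F.obj B).map f) ≫ (assoc A B Y).hom =
      (assoc A B X).hom ≫ (F.obj (A ⊗ B)).map f

/-- The central element `α` is induced by the action `M`, i.e. `α = α_f` for some graded
endomorphism `f` of the unit `𝟙`. -/
def MonoidalAction.Induces {F : S ⥤ C ⥤ C} (M : MonoidalAction F) (α : Central C) : Prop :=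
  ∃ f : (𝟙_ S) ⟶ (𝟙_ S)⟦α.d⟧, ∀ X : C,
    α.app X = (M.unit X).inv ≫ (F.map f).app X ≫ (M.θ α.d (𝟙_ S) X).hom ≫
      ((M.unit X).hom⟦α.d⟧')

end Central

section Thickenings

variable {C : Type u₁} [Category.{v₁} C] [Preadditive C] [HasZeroObject C] [HasShift C ℤ]
  [∀ n : ℤ, (shiftFunctor C n).Additive] [Pretriangulated C]

open scoped ZeroObject

section Exactness

variable {X Y Z T : C} {f : X ⟶ Y} {g : Y ⟶ Z} {h : Z ⟶ X⟦(1 : ℤ)⟧}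

lemma mk_distTriang_comp_zero₂₃ (hT : Triangle.mk f g h ∈ distTriang C) : g ≫ h = 0 :=
  comp_distTriang_mor_zero₂₃ _ hT

lemma mk_distTriang_desc (hT : Triangle.mk f g h ∈ distTriang C) (x : Y ⟶ T) (hx : f ≫ x = 0) :
    ∃ y : Z ⟶ T, x = g ≫ y :=
  Triangle.yoneda_exact₂ _ hT x hx

lemma mk_distTriang_lift₂ (hT : Triangle.mk f g h ∈ distTriang C) (x : T ⟶ Y)
    (hx : x ≫ g = 0) : ∃ y : T ⟶ X, x = y ≫ f :=
  Triangle.coyoneda_exact₂ _ hT x hx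

lemma mk_distTriang_lift₃ (hT : Triangle.mk f g h ∈ distTriang C) (x : T ⟶ Z)
    (hx : x ≫ h = 0) : ∃ y : T ⟶ Y, x = y ≫ g :=
  Triangle.coyoneda_exact₃ _ hT x hx

lemma mk_distTriang_isIso₁ (hT : Triangle.mk f g h ∈ distTriang C) (hZ : IsZero Z) : IsIso f :=
  (Triangle.isZero₃_iff_isIso₁ _ hT).1 hZ

end Exactness

lemma mk_distTriang_of_iso₂ {A R R' B : C} {a : A ⟶ R} {b : R ⟶ B} {c : B ⟶ A⟦(1 : ℤ)⟧}
    (h : Triangle.mk a b c ∈ distTriang C) (e : R ≅ R') :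
    Triangle.mk (a ≫ e.hom) (e.inv ≫ b) c ∈ distTriang C :=
  isomorphic_distinguished _ h _ (Triangle.isoMk _ _ (Iso.refl _) e.symm (Iso.refl _)
    (by change (a ≫ e.hom) ≫ e.inv = 𝟙 A ≫ a; simp)
    (by change (e.inv ≫ b) ≫ 𝟙 B = e.inv ≫ b; simp)
    (by change c ≫ (𝟙 A)⟦(1 : ℤ)⟧' = 𝟙 B ≫ c; simp))

/-- A retract diagram between the third objects of two distinguished triangles with the same first
object lifts to a retract diagram between the second objects. -/
lemma exists_retract_obj₂ {A Q P Q' P' : C} {a : A ⟶ Q} {q : Q ⟶ P} {δ : P ⟶ A⟦(1 : ℤ)⟧}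
    {a' : A ⟶ Q'} {q' : Q' ⟶ P'} {δ' : P' ⟶ A⟦(1 : ℤ)⟧}
    (h : Triangle.mk a q δ ∈ distTriang C) (h' : Triangle.mk a' q' δ' ∈ distTriang C)
    (i : P ⟶ P') (r : P' ⟶ P) (hir : i ≫ r = 𝟙 P) (hi : i ≫ δ' = δ) (hr : r ≫ δ = δ') :
    ∃ (i' : Q ⟶ Q') (r' : Q' ⟶ Q), i' ≫ r' = 𝟙 Q := by
  obtain ⟨b, hb₁, hb₂⟩ : ∃ b : Q ⟶ Q', a ≫ b = 𝟙 A ≫ a' ∧ q ≫ i = b ≫ q' :=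
    complete_distinguished_triangle_morphism₂ _ _ h h' (𝟙 A) i
      (show δ ≫ (𝟙 A)⟦(1 : ℤ)⟧' = i ≫ δ' by rw [CategoryTheory.Functor.map_id, comp_id, hi])
  obtain ⟨c, hc₁, hc₂⟩ : ∃ c : Q' ⟶ Q, a' ≫ c = 𝟙 A ≫ a ∧ q' ≫ r = c ≫ q :=
    complete_distinguished_triangle_morphism₂ _ _ h' h (𝟙 A) r
      (show δ' ≫ (𝟙 A)⟦(1 : ℤ)⟧' = r ≫ δ by rw [CategoryTheory.Functor.map_id, comp_id, hr])
  rw [id_comp] at hb₁ hc₁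
  obtain ⟨x, hx⟩ := mk_distTriang_lift₂ h (𝟙 Q - b ≫ c) (by
    rw [Preadditive.sub_comp, assoc, ← hc₂, ← reassoc_of% hb₂, hir]
    simp)
  have hsq : (𝟙 Q - b ≫ c) ≫ (𝟙 Q - b ≫ c) = 0 := by
    nth_rw 1 [hx]
    rw [assoc, Preadditive.comp_sub, reassoc_of% hb₁, hc₁]
    simp
  refine ⟨b, c ≫ (𝟙 Q + (𝟙 Q - b ≫ c)), ?_⟩
  have key : b ≫ c = 𝟙 Q - (𝟙 Q - b ≫ c) := by abel
  rw [← assoc]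
  nth_rw 1 [key]
  rw [Preadditive.sub_comp, Preadditive.comp_add, Preadditive.comp_add, hsq]
  simp

/-- A weak form of the octahedral axiom, valid in any pretriangulated category: given
distinguished triangles `A ⟶ Q ⟶ P ⟶ ΣA` and `A₂ ⟶ P ⟶ Q₂ ⟶ ΣA₂` such that `A₂ ⟶ P ⟶ ΣA` vanishes,
the object `Q` is a retract of `R ⊞ (A ⊞ A₂)` for some extension `A ⊞ A₂ ⟶ R ⟶ Q₂`. -/
lemma exists_weak_octahedron [HasBinaryBiproducts C] {A Q P A₂ Q₂ : C} {a : A ⟶ Q} {q : Q ⟶ P}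
    {δ : P ⟶ A⟦(1 : ℤ)⟧}
    {i : A₂ ⟶ P} {π : P ⟶ Q₂} {d : Q₂ ⟶ A₂⟦(1 : ℤ)⟧}
    (h : Triangle.mk a q δ ∈ distTriang C) (h₂ : Triangle.mk i π d ∈ distTriang C)
    (hz : i ≫ δ = 0) :
    ∃ (R : C) (k : A ⊞ A₂ ⟶ R) (r : R ⟶ Q₂) (e : Q₂ ⟶ (A ⊞ A₂)⟦(1 : ℤ)⟧)
      (w : Q ⟶ R) (w' : R ⟶ Q) (l : Q ⟶ A ⊞ A₂) (l' : A ⊞ A₂ ⟶ Q),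
      Triangle.mk k r e ∈ distTriang C ∧ w ≫ w' + l ≫ l' = 𝟙 Q := by
  obtain ⟨δ', hδ'⟩ := mk_distTriang_desc h₂ δ hz
  obtain ⟨s, hs⟩ := mk_distTriang_lift₃ h i hz
  have hqδ := mk_distTriang_comp_zero₂₃ h
  have hπd := mk_distTriang_comp_zero₂₃ h₂
  let e : Q₂ ⟶ (A ⊞ A₂)⟦(1 : ℤ)⟧ := δ' ≫ biprod.inl⟦(1 : ℤ)⟧' + d ≫ biprod.inr⟦(1 : ℤ)⟧'
  have he₁ : e ≫ biprod.fst⟦(1 : ℤ)⟧' = δ' := by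
    simp [e, ← Functor.map_comp]
  have he₂ : e ≫ biprod.snd⟦(1 : ℤ)⟧' = d := by
    simp [e, ← Functor.map_comp]
  obtain ⟨R, k, r, hR⟩ := distinguished_cocone_triangle₂ e
  have hre := mk_distTriang_comp_zero₂₃ hR
  obtain ⟨w, hw⟩ := mk_distTriang_lift₃ hR (q ≫ π) (by
    have h₁ : q ≫ π ≫ δ' = 0 := by rw [← hδ', hqδ]
    simp [e, reassoc_of% hπd, reassoc_of% h₁])
  have hrδ : r ≫ δ' = 0 := by rw [← he₁, reassoc_of% hre, zero_comp]
  have hrd : r ≫ d = 0 := by rw [← he₂, reassoc_of% hre, zero_comp]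
  obtain ⟨y, hy⟩ := mk_distTriang_lift₃ h₂ r hrd
  obtain ⟨w', hw'⟩ := mk_distTriang_lift₃ h y (by rw [hδ', ← assoc, ← hy, hrδ])
  obtain ⟨b, hb⟩ := mk_distTriang_lift₂ h₂ ((𝟙 Q - w ≫ w') ≫ q) (by
    rw [assoc, Preadditive.sub_comp, assoc, ← reassoc_of% hw', ← hy, hw]
    simp)
  obtain ⟨c, hc⟩ := mk_distTriang_lift₂ h (𝟙 Q - w ≫ w' - b ≫ s) (by
    rw [Preadditive.sub_comp, hb, assoc, ← hs, sub_self])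
  refine ⟨R, k, r, e, w, w', biprod.lift c b, biprod.desc a s, hR, ?_⟩
  rw [biprod.lift_desc, ← hc]
  abel

variable [HasBinaryBiproducts C]

lemma Thick1.of_iso {X Y Z : C} (e : Y ≅ Z) (h : Thick1 X Y) : Thick1 X Z :=
  .retract Y Z e.inv e.hom e.inv_hom_id h

lemma thickN_succ_of_retract {X : C} {m : ℕ} {A R B Y : C} {a : A ⟶ R} {b : R ⟶ B}
    {c : B ⟶ A⟦(1 : ℤ)⟧} (h : Triangle.mk a b c ∈ distTriang C) (hA : Thick1 X A)
    (hB : ThickN X m B) (i : Y ⟶ R) (r : R ⟶ Y) (hir : i ≫ r = 𝟙 Y) : ThickN X (m + 1) Y := by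
  match m, hB with
  | 0, hB =>
    have : IsIso a := mk_distTriang_isIso₁ h hB
    exact .retract R Y i r hir (hA.of_iso (asIso a))
  | m + 1, hB =>
    have hi : Mono i := mono_of_mono_fac hir
    obtain ⟨Z, g, w, hT⟩ := distinguished_cocone_triangle i
    obtain ⟨e, -⟩ : ∃ e : R ≅ Y ⊞ Z, i ≫ e.hom = biprod.inl ∧ g = e.hom ≫ biprod.snd :=
      exists_iso_binaryBiproduct_of_distTriang _ hT (Triangle.mor₃_eq_zero_of_mono₁ _ hT hi)
    exact ⟨A, Z, B, a ≫ e.hom, e.inv ≫ b, c, mk_distTriang_of_iso₂ h e, hA, hB⟩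

lemma ThickN.retract {X : C} {m : ℕ} {Y Z : C} (i : Y ⟶ Z) (r : Z ⟶ Y) (hir : i ≫ r = 𝟙 Y)
    (h : ThickN X m Z) : ThickN X m Y := by
  match m, h with
  | 0, h => exact (IsZero.iff_id_eq_zero Y).2 (by rw [← hir, h.eq_of_tgt i 0, zero_comp])
  | 1, h => exact Thick1.retract Z Y i r hir h
  | m + 2, ⟨A, Zt, B, a, b, c, hT, hA, hB⟩ =>
    exact thickN_succ_of_retract hT hA hB (i ≫ biprod.inl) (biprod.fst ≫ r) (by simp [hir])

lemma ThickN.of_iso {X : C} {m : ℕ} {Y Z : C} (e : Y ≅ Z) (h : ThickN X m Y) : ThickN X m Z :=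
  h.retract e.inv e.hom e.inv_hom_id

/-- Enlarging the first term of an extension by a direct summand. -/
lemma thickN_succ_of_retract_sum {X : C} {m : ℕ} {A R B Y Z : C} {a : A ⟶ R} {b : R ⟶ B}
    {c : B ⟶ A⟦(1 : ℤ)⟧} (h : Triangle.mk a b c ∈ distTriang C) (hA : Thick1 X A)
    (hZ : Thick1 X Z) (hB : ThickN X m B) (w : Y ⟶ R) (w' : R ⟶ Y) (l : Y ⟶ Z) (l' : Z ⟶ Y)
    (hw : w ≫ w' + l ≫ l' = 𝟙 Y) : ThickN X (m + 1) Y := by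
  obtain ⟨R', k, r, hR'⟩ := distinguished_cocone_triangle₂ (c ≫ (biprod.inl : A ⟶ A ⊞ Z)⟦(1 : ℤ)⟧')
  obtain ⟨x, hx₁, hx₂⟩ : ∃ x : R ⟶ R', a ≫ x = biprod.inl ≫ k ∧ b ≫ 𝟙 B = x ≫ r :=
    complete_distinguished_triangle_morphism₂ _ _ h hR' biprod.inl (𝟙 B) (id_comp _).symm
  obtain ⟨y, hy₁, hy₂⟩ : ∃ y : R' ⟶ R, k ≫ y = biprod.fst ≫ a ∧ r ≫ 𝟙 B = y ≫ b :=
    complete_distinguished_triangle_morphism₂ _ _ hR' h biprod.fst (𝟙 B)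
      (show (c ≫ biprod.inl⟦(1 : ℤ)⟧') ≫ biprod.fst⟦(1 : ℤ)⟧' = 𝟙 B ≫ c by
        rw [assoc, ← Functor.map_comp, biprod.inl_fst, CategoryTheory.Functor.map_id, comp_id,
          id_comp])
  obtain ⟨t, ht, -⟩ : ∃ t : R' ⟶ Z, k ≫ t = biprod.snd ≫ 𝟙 Z ∧ r ≫ 0 = t ≫ (0 : Z ⟶ 0) :=
    complete_distinguished_triangle_morphism₂ _ _ hR' (contractible_distinguished Z) biprod.snd 0
      (show (c ≫ biprod.inl⟦(1 : ℤ)⟧') ≫ biprod.snd⟦(1 : ℤ)⟧' = 0 ≫ 0 by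
        rw [assoc, ← Functor.map_comp, biprod.inl_snd, Functor.map_zero, comp_zero, comp_zero])
  rw [comp_id] at hx₂ hy₂ ht
  obtain ⟨n, hn⟩ : ∃ n, n = 𝟙 R - x ≫ y := ⟨_, rfl⟩
  have hxy : x ≫ y = 𝟙 R - n := by rw [hn]; abel
  obtain ⟨z, hz⟩ := mk_distTriang_lift₂ h n (by
    rw [hn, Preadditive.sub_comp, assoc, ← hy₂, ← hx₂, id_comp, sub_self])
  have han : a ≫ n = 0 := by
    rw [hn, Preadditive.comp_sub, reassoc_of% hx₁, hy₁, biprod.inl_fst_assoc, comp_id, sub_self]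
  have hnn : n ≫ n = 0 := by
    nth_rw 1 [hz]
    rw [assoc, han, comp_zero]
  have hky : (biprod.inr : Z ⟶ A ⊞ Z) ≫ k ≫ y = 0 := by simp [hy₁]
  have hkt : (biprod.inr : Z ⟶ A ⊞ Z) ≫ k ≫ t = 𝟙 Z := by simp [ht]
  have hxy' : x ≫ y ≫ (𝟙 R + n) = 𝟙 R := by
    rw [← assoc, hxy, Preadditive.sub_comp, Preadditive.comp_add, Preadditive.comp_add, hnn]
    simp
  obtain ⟨v, hxv, hkv⟩ : ∃ v : R' ⟶ Y, x ≫ v = w' ∧ (biprod.inr : Z ⟶ A ⊞ Z) ≫ k ≫ v = 0 :=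
    ⟨y ≫ (𝟙 R + n) ≫ w', by rw [← assoc y, ← assoc x, hxy', id_comp],
      by rw [reassoc_of% hky, zero_comp]⟩
  refine thickN_succ_of_retract hR' (.sum _ _ hA hZ) hB
    (w ≫ (x - (x ≫ t) ≫ biprod.inr ≫ k) + l ≫ biprod.inr ≫ k) (v + t ≫ l') ?_
  simp only [Preadditive.add_comp, Preadditive.comp_add, Preadditive.comp_sub,
    Preadditive.sub_comp, assoc, reassoc_of% hkt, hxv, hkv, comp_zero]
  rw [← hw]
  abel

/-- Extension lemma for thickenings which replaces the octahedral axiom. -/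
lemma thickN_succ_of_fiber {X : C} {m : ℕ} {A Q P A₂ Q₂ : C} {a : A ⟶ Q} {q : Q ⟶ P}
    {δ : P ⟶ A⟦(1 : ℤ)⟧} {i : A₂ ⟶ P} {π : P ⟶ Q₂} {d : Q₂ ⟶ A₂⟦(1 : ℤ)⟧}
    (h : Triangle.mk a q δ ∈ distTriang C) (h₂ : Triangle.mk i π d ∈ distTriang C)
    (hz : i ≫ δ = 0) (hA : Thick1 X A) (hA₂ : Thick1 X A₂) (hQ₂ : ThickN X m Q₂) :
    ThickN X (m + 1) Q := by
  obtain ⟨R, k, r, e, w, w', l, l', hR, hw⟩ := exists_weak_octahedron h h₂ hz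
  exact thickN_succ_of_retract_sum hR (.sum _ _ hA hA₂) (.sum _ _ hA hA₂) hQ₂ w w' l l' hw

lemma thickN_succ_of_fiber_rotate {X : C} {m : ℕ} {A Q P A₂ Q₂ : C} {a : A ⟶ Q} {q : Q ⟶ P}
    {δ : P ⟶ A⟦(1 : ℤ)⟧} {π : P ⟶ Q₂} {d : Q₂ ⟶ A₂} {i : A₂ ⟶ P⟦(1 : ℤ)⟧}
    (h : Triangle.mk a q δ ∈ distTriang C) (h₂ : Triangle.mk π d i ∈ distTriang C)
    (hz : i ≫ δ⟦(1 : ℤ)⟧' = 0) (hA : Thick1 X A) (hA₂ : Thick1 X A₂) (hQ₂ : ThickN X m Q₂) :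
    ThickN X (m + 1) Q := by
  refine thickN_succ_of_fiber h (inv_rot_of_distTriang _ h₂) ?_ hA (.shift _ _ hA₂) hQ₂
  have aux (ηP : (P⟦(1 : ℤ)⟧)⟦(-1 : ℤ)⟧ ⟶ P)
      (ηA : ((A⟦(1 : ℤ)⟧)⟦(1 : ℤ)⟧)⟦(-1 : ℤ)⟧ ⟶ A⟦(1 : ℤ)⟧)
      (hη : (δ⟦(1 : ℤ)⟧')⟦(-1 : ℤ)⟧' ≫ ηA = ηP ≫ δ) : (-(i⟦(-1 : ℤ)⟧' ≫ ηP)) ≫ δ = 0 := by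
    rw [Preadditive.neg_comp, assoc, ← hη, ← assoc, ← Functor.map_comp, hz, Functor.map_zero,
      zero_comp, neg_zero]
  exact aux _ _ ((shiftEquiv C (1 : ℤ)).unitIso.inv.naturality δ)

end Thickenings

section BiexactZero

variable {C : Type u₁} [Category.{v₁} C] [Preadditive C] [HasZeroObject C] [HasShift C ℤ]
  [∀ n : ℤ, (shiftFunctor C n).Additive] [Pretriangulated C]
variable {D : Type u₂} [Category.{v₂} D] [Preadditive D] [HasZeroObject D] [HasShift D ℤ]
  [∀ n : ℤ, (shiftFunctor D n).Additive] [Pretriangulated D]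
variable {E : Type u₃} [Category.{v₃} E] [Preadditive E] [HasZeroObject E] [HasShift E ℤ]
  [∀ n : ℤ, (shiftFunctor E n).Additive] [Pretriangulated E]
variable {F : C ⥤ D ⥤ E}

open scoped ZeroObject

/-- A biexact functor vanishes on zero objects of the first variable. -/
lemma Biexact.isZero_left (B : Biexact F) {Z : C} (hZ : IsZero Z) (X' : D) :
    IsZero ((F.obj Z).obj X') := by
  have h : (F.map (𝟙 Z)).app X' ≫ (F.map (0 : Z ⟶ 0)).app X' = 0 :=
    comp_distTriang_mor_zero₁₂ _ (B.ex₁ _ (contractible_distinguished Z) X')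
  have h₀ : (0 : Z ⟶ 0) = hZ.isoZero.hom := hZ.eq_of_src _ _
  rw [CategoryTheory.Functor.map_id, NatTrans.id_app, id_comp, h₀] at h
  rw [IsZero.iff_id_eq_zero, ← NatTrans.id_app, ← CategoryTheory.Functor.map_id, ← hZ.isoZero.hom_inv_id,
    Functor.map_comp, NatTrans.comp_app, h, zero_comp]

/-- A biexact functor vanishes on zero objects of the second variable. -/
lemma Biexact.isZero_right (B : Biexact F) (X : C) {Z : D} (hZ : IsZero Z) :
    IsZero ((F.obj X).obj Z) := by
  have h : (F.obj X).map (𝟙 Z) ≫ (F.obj X).map (0 : Z ⟶ 0) = 0 :=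
    comp_distTriang_mor_zero₁₂ _ (B.ex₂ X _ (contractible_distinguished Z))
  have h₀ : (0 : Z ⟶ 0) = hZ.isoZero.hom := hZ.eq_of_src _ _
  rw [CategoryTheory.Functor.map_id, id_comp, h₀] at h
  rw [IsZero.iff_id_eq_zero, ← CategoryTheory.Functor.map_id, ← hZ.isoZero.hom_inv_id, Functor.map_comp, h,
    zero_comp]

lemma Biexact.map_zero_app (B : Biexact F) (X Y : C) (X' : D) :
    (F.map (0 : X ⟶ Y)).app X' = 0 := by
  have h₀ : (0 : X ⟶ Y) = (0 : X ⟶ 0) ≫ (0 : (0 : C) ⟶ Y) := by simp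
  rw [h₀, Functor.map_comp, NatTrans.comp_app, 
    (B.isZero_left (isZero_zero C) X').eq_of_tgt ((F.map (0 : X ⟶ (0 : C))).app X') 0,
    zero_comp]

end BiexactZero

section Action

open scoped ZeroObject

variable {C : Type u₁} [Category.{v₁} C] [Preadditive C] [HasZeroObject C] [HasShift C ℤ]
  [∀ n : ℤ, (shiftFunctor C n).Additive] [Pretriangulated C] [HasBinaryBiproducts C]
variable {S : Type u₂} [Category.{v₂} S] [Preadditive S] [HasZeroObject S] [HasShift S ℤ]
  [∀ n : ℤ, (shiftFunctor S n).Additive] [Pretriangulated S] [HasBinaryBiproducts S]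
  [MonoidalCategory S] {F : S ⥤ C ⥤ C}

lemma MonoidalAction.thick1_obj_shift_unit (M : MonoidalAction F) {X B : C} (h : Thick1 X B)
    (n : ℤ) : Thick1 X ((F.obj ((𝟙_ S)⟦n⟧)).obj B) :=
  .of_iso (M.θ n _ B).symm (.shift n _ (.of_iso (M.unit B).symm h))

/-- Let `K` be a cone of a graded endomorphism of the unit. Then fibers of morphisms
`F(K, B) ⟶ F(Σ𝟙, B) ⟶ ΣV` with `V ∈ thick¹(X)` are built in one more step than `B`. -/
lemma MonoidalAction.thickN_succ_of_fiber (M : MonoidalAction F)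
    (hV : StrongVerdier F M.toBiexact) {d : ℤ} {f : 𝟙_ S ⟶ (𝟙_ S)⟦d⟧} {K : S}
    {g : (𝟙_ S)⟦d⟧ ⟶ K} {h : K ⟶ (𝟙_ S)⟦(1 : ℤ)⟧} (hf : Triangle.mk f g h ∈ distTriang S)
    {X : C} (m : ℕ) :
    ∀ {B V Q : C} {a : V ⟶ Q} {q : Q ⟶ (F.obj K).obj B}
      (φ : (F.obj ((𝟙_ S)⟦(1 : ℤ)⟧)).obj B ⟶ V⟦(1 : ℤ)⟧),
      Triangle.mk a q ((F.map h).app B ≫ φ) ∈ distTriang C →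
      Thick1 X V → ThickN X m B → ThickN X (m + 1) Q := by
  have hgh := mk_distTriang_comp_zero₂₃ hf
  induction m with
  | zero =>
    intro B V Q a q φ hT hVX hB
    have : IsIso a := mk_distTriang_isIso₁ hT (M.toBiexact.isZero_right K hB)
    exact hVX.of_iso (asIso a)
  | succ m ih =>
    intro B V Q a q φ hT hVX hB
    cases m with
    | zero =>
      refine _root_.thickN_succ_of_fiber (π := (F.map h).app B) hT
        (M.ex₁ _ (rot_of_distTriang _ hf) B) ?_ hVX ?_ (M.thick1_obj_shift_unit hB 1)
      · change (F.map g).app B ≫ (F.map h).app B ≫ φ = 0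
        rw [← Category.assoc, ← NatTrans.comp_app, ← Functor.map_comp, hgh, M.map_zero_app, zero_comp]
      · exact M.thick1_obj_shift_unit hB d
    | succ m =>
      obtain ⟨B', Bt, B'', u, v, c, hE, hB', hB''⟩ := hB
      let φ' := (F.obj ((𝟙_ S)⟦(1 : ℤ)⟧)).map (biprod.fst : B ⊞ Bt ⟶ B) ≫ φ
      obtain ⟨Q', a', q', hT'⟩ := distinguished_cocone_triangle₂ ((F.map h).app (B ⊞ Bt) ≫ φ')
      obtain ⟨i, r, hir⟩ := exists_retract_obj₂ hT hT' ((F.obj K).map biprod.inl)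
        ((F.obj K).map biprod.fst) (by simp [← Functor.map_comp])
        (by simp [φ', ← Functor.map_comp_assoc]) (by simp [φ'])
      refine ThickN.retract i r hir ?_
      obtain ⟨W, j, p, -, -, j', p', hW₁, -, hW₂, -⟩ :=
        hV (rot_of_distTriang _ (rot_of_distTriang _ hf)) hE
      refine thickN_succ_of_fiber_rotate hT' hW₁ ?_ hVX ?_
        (ih _ hW₂ (M.thick1_obj_shift_unit hB' 1) hB'')
      · change ((F.map (-g⟦(1 : ℤ)⟧')).app B' ≫ (F.obj (K⟦(1 : ℤ)⟧)).map u ≫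
          (M.θ 1 K (B ⊞ Bt)).hom) ≫ ((F.map h).app (B ⊞ Bt) ≫ φ')⟦(1 : ℤ)⟧' = 0
        have hgh' : (-g⟦(1 : ℤ)⟧') ≫ h⟦(1 : ℤ)⟧' = 0 := by
          rw [Preadditive.neg_comp, ← Functor.map_comp, hgh, Functor.map_zero, neg_zero]
        have hgh₀ : (F.map (-g⟦(1 : ℤ)⟧')).app B' ≫ (F.map (h⟦(1 : ℤ)⟧')).app B' = 0 := by
          rw [← NatTrans.comp_app, ← Functor.map_comp, hgh', M.map_zero_app]
        rw [Functor.map_comp, Category.assoc, Category.assoc, ← reassoc_of% M.θ_natural₁ 1 h (B ⊞ Bt),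
          NatTrans.naturality_assoc, reassoc_of% hgh₀, zero_comp]
      · exact .of_iso (M.θ 1 _ B').symm (.shift 1 _ (M.thick1_obj_shift_unit hB' d))

/-- A cone of the central element induced by an action is built in one more step. -/
lemma MonoidalAction.Induces.thickN_succ {M : MonoidalAction F} {α : Central C}
    (hα : M.Induces α) (hV : StrongVerdier F M.toBiexact) {X Y K : C} {m : ℕ}
    (hK : IsCone (α.app Y) K) (hY : ThickN X m Y) : ThickN X (m + 1) K := by
  obtain ⟨f, hf⟩ := hα
  obtain ⟨L, g, h, hT⟩ := distinguished_cocone_triangle f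
  obtain ⟨a, b, hK⟩ := hK
  let e₁ := M.unit Y
  let e₂ := M.θ α.d (𝟙_ S) Y ≪≫ (shiftFunctor C α.d).mapIso (M.unit Y)
  have e := isoTriangleOfIso₁₂ _ _ (M.ex₁ _ hT Y) hK e₁ e₂
    (show (F.map f).app Y ≫ e₂.hom = e₁.hom ≫ α.app Y by simp [e₁, e₂, hf])
  refine ThickN.of_iso (Triangle.π₃.mapIso e) ?_
  refine M.thickN_succ_of_fiber hV hT m (V := 0) 0 (q := 𝟙 _) (a := 0) ?_ (.zero _ (isZero_zero C))
    hY
  rw [comp_zero]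
  exact contractible_distinguished₁ _

end Action

lemma thickN_koszul {C : Type u₁} [Category.{v₁} C] [Preadditive C] [HasZeroObject C]
    [HasShift C ℤ] [∀ n : ℤ, (shiftFunctor C n).Additive] [Pretriangulated C]
    [HasBinaryBiproducts C] {X : C} (l : List (Central C))
    (hl : ∀ α ∈ l, ∀ {Y K : C} {m : ℕ}, IsCone (α.app Y) K → ThickN X m Y → ThickN X (m + 1) K)
    {Y K : C} {m : ℕ} (hK : IsKoszulObj l Y K) (hY : ThickN X m Y) :
    ThickN X (m + l.length) K := by
  induction l generalizing Y m with
  | nil =>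
    obtain ⟨e⟩ := hK
    exact hY.of_iso e
  | cons α l ih =>
    obtain ⟨K', hK', hK⟩ := hK
    have := ih (fun β hβ => hl β (List.mem_cons_of_mem _ hβ)) hK
      (hl α List.mem_cons_self hK' hY)
    rwa [List.length_cons, Nat.add_comm l.length, ← Nat.add_assoc]

/-- If each `αᵢ` in a sequence of `c` central elements of `𝒯` is induced by an action of a
monoidal triangulated category admitting a strong Verdier structure, then
`level^X(Y ∥ (α₁, …, α_c)) ≤ level^X(Y) + c`. -/
theorem level_koszul_obj
    {C : Type u₁} [Category.{v₁} C] [Preadditive C] [HasZeroObject C] [HasShift C ℤ]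
    [∀ n : ℤ, (shiftFunctor C n).Additive] [Pretriangulated C] [HasBinaryBiproducts C]
    {c : ℕ} (S : Fin c → Type u₂) [∀ i, Category.{v₂} (S i)] [∀ i, Preadditive (S i)]
    [∀ i, HasZeroObject (S i)] [∀ i, HasShift (S i) ℤ]
    [∀ i, ∀ n : ℤ, (shiftFunctor (S i) n).Additive] [∀ i, Pretriangulated (S i)]
    [∀ i, HasBinaryBiproducts (S i)] [∀ i, MonoidalCategory (S i)]
    (F : ∀ i, S i ⥤ C ⥤ C) (M : ∀ i, MonoidalAction (F i))
    (α : Fin c → Central C) (hind : ∀ i, (M i).Induces (α i))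
    (hV : ∀ i, StrongVerdier (F i) (M i).toBiexact)
    (X Y KY : C) (hKY : IsKoszulObj (List.ofFn α) Y KY) :
    level X KY ≤ level X Y + c := by
  by_cases hY : level X Y = ⊤
  · simp [hY]
  · have hne : {n : ℕ∞ | ∃ m : ℕ, n = m ∧ ThickN X m Y}.Nonempty := by
      by_contra hn
      exact hY (by rw [level, Set.not_nonempty_iff_eq_empty.1 hn, sInf_empty])
    obtain ⟨m, hm, hYm⟩ := csInf_mem hne
    have h := thickN_koszul (List.ofFn α) (fun β hβ => by
      obtain ⟨i, rfl⟩ := (List.mem_ofFn' _ _).1 hβ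
      exact (hind i).thickN_succ (hV i)) hKY hYm
    rw [List.length_ofFn] at h
    have hle : level X KY ≤ ((m + c : ℕ) : ℕ∞) := sInf_le ⟨_, rfl, h⟩
    have hm' : level X Y = m := hm
    rw [hm']
    exact_mod_cast hle
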